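/- The Hardy–Ramanujan asymptotic formula: as n → ∞, the partition function satisfies p(n) ~ exp(π·√(2n/3)) / (4n·√3), i.e., the ratio of p(n) to exp(π·√(2n/3))/(4n·√3) tends to 1 as n tends to infinity. -/

import Mathlib

open Real Filter

open scoped Topology

/-- Euler's product `∏ (1 - q ^ (n + 1))`. -/
noncomputable def eulerProd (q : ℂ) : ℂ := ∏' n : ℕ, (1 - q ^ (n + 1))

section GeneratingFunction

open PowerSeries PowerSeries.WithPiTopology

lemma coeff_tsum_X_pow_mul {d : ℕ} (hd : 0 < d) (n : ℕ) :
    coeff n (∑' j : ℕ, (X : PowerSeries ℂ) ^ (d * j)) = if d ∣ n then 1 else 0 := by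
  have hs : Summable fun j : ℕ ↦ (X : PowerSeries ℂ) ^ (d * j) := by
    simp_rw [pow_mul]
    exact summable_pow_of_constantCoeff_eq_zero (by simp [hd.ne'])
  rw [hs.map_tsum _ (continuous_coeff ℂ n)]
  split_ifs with h
  · obtain ⟨k, rfl⟩ := h
    rw [tsum_eq_single k]
    · simp
    · intro b hb
      have : d * k ≠ d * b := fun h ↦ hb (Nat.eq_of_mul_eq_mul_left hd h).symm
      simp [coeff_X_pow, this]
  · convert! tsum_zero with j
    have : n ≠ d * j := fun h' ↦ h ⟨j, h'⟩
    simp [coeff_X_pow, this]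

lemma hasSum_ite_dvd_mul_pow {d : ℕ} (hd : 0 < d) {q : ℂ} (hq : ‖q‖ < 1) :
    HasSum (fun n : ℕ ↦ (if d ∣ n then 1 else 0) * q ^ n) (1 - q ^ d)⁻¹ := by
  have hinj : Function.Injective fun j : ℕ ↦ d * j := fun a b h ↦ Nat.eq_of_mul_eq_mul_left hd h
  rw [← hinj.hasSum_iff]
  · have : ‖q ^ d‖ < 1 := by
      rw [norm_pow]
      exact pow_lt_one₀ (norm_nonneg _) hq hd.ne'
    convert! hasSum_geometric_of_norm_lt_one this using 2 with j
    simp [pow_mul]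
  · intro n hn
    have : ¬ d ∣ n := fun ⟨k, hk⟩ ↦ hn ⟨k, hk.symm⟩
    simp [this]

lemma summable_norm_ite_dvd_mul_pow (d : ℕ) {q : ℂ} (hq : ‖q‖ < 1) :
    Summable fun n : ℕ ↦ ‖(if d ∣ n then 1 else 0) * q ^ n‖ := by
  refine (summable_geometric_of_lt_one (norm_nonneg q) hq).of_nonneg_of_le
    (fun _ ↦ norm_nonneg _) fun n ↦ ?_
  split_ifs <;> simp

lemma summable_norm_and_tsum_coeff_prod (q : ℂ) (F : ℕ → PowerSeries ℂ)
    (hF : ∀ i, Summable fun n ↦ ‖coeff n (F i) * q ^ n‖) (M : ℕ) :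
    (Summable fun n ↦ ‖coeff n (∏ i ∈ Finset.range M, F i) * q ^ n‖) ∧
      ∑' n, coeff n (∏ i ∈ Finset.range M, F i) * q ^ n =
        ∏ i ∈ Finset.range M, ∑' n, coeff n (F i) * q ^ n := by
  induction M with
  | zero =>
    have h (n : ℕ) (hn : n ≠ 0) : coeff n (1 : PowerSeries ℂ) * q ^ n = 0 := by
      simp [coeff_one, hn]
    simp only [Finset.range_zero, Finset.prod_empty]
    refine ⟨summable_of_ne_finset_zero (s := {0}) fun n hn ↦ ?_, ?_⟩
    · rw [h n (by simpa using hn), norm_zero]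
    · rw [tsum_eq_single 0 h]
      simp
  | succ M ih =>
    have key (n : ℕ) : coeff n ((∏ i ∈ Finset.range M, F i) * F M) * q ^ n =
        ∑ kl ∈ Finset.HasAntidiagonal.antidiagonal n,
          (coeff kl.1 (∏ i ∈ Finset.range M, F i) * q ^ kl.1) * (coeff kl.2 (F M) * q ^ kl.2) := by
      rw [coeff_mul, Finset.sum_mul]
      refine Finset.sum_congr rfl fun kl hkl ↦ ?_
      rw [← Finset.HasAntidiagonal.mem_antidiagonal.mp hkl, pow_add]
      ring
    simp_rw [Finset.prod_range_succ, key]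
    constructor
    · exact summable_norm_sum_mul_antidiagonal_of_summable_norm
        (f := fun k ↦ coeff k (∏ i ∈ Finset.range M, F i) * q ^ k)
        (g := fun k ↦ coeff k (F M) * q ^ k) ih.1 (hF M)
    · rw [← tsum_mul_tsum_eq_tsum_sum_antidiagonal_of_summable_norm
        (f := fun k ↦ coeff k (∏ i ∈ Finset.range M, F i) * q ^ k)
        (g := fun k ↦ coeff k (F M) * q ^ k) ih.1 (hF M), ih.2]

lemma mk_card_restricted_le_eq_prod (M : ℕ) :
    PowerSeries.mk (fun n ↦ ((Nat.Partition.restricted n (· ≤ M)).card : ℂ)) =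
      ∏ i ∈ Finset.range M, ∑' j : ℕ, (X : PowerSeries ℂ) ^ ((i + 1) * j) := by
  refine (Nat.Partition.hasProd_powerSeriesMk_card_restricted ℂ (· ≤ M)).unique ?_
  rw [← Finset.prod_congr rfl fun i hi ↦ if_pos (c := i + 1 ≤ M) (Finset.mem_range.mp hi)]
  exact hasProd_prod_of_ne_finset_one fun i hi ↦ if_neg fun h ↦ hi (Finset.mem_range.mpr h)

lemma summable_norm_and_tsum_card_restricted {q : ℂ} (hq : ‖q‖ < 1) (M : ℕ) :
    (Summable fun n ↦ ‖((Nat.Partition.restricted n (· ≤ M)).card : ℂ) * q ^ n‖) ∧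
      ∑' n, ((Nat.Partition.restricted n (· ≤ M)).card : ℂ) * q ^ n =
        (∏ i ∈ Finset.range M, (1 - q ^ (i + 1)))⁻¹ := by
  have h := summable_norm_and_tsum_coeff_prod q
    (fun i ↦ ∑' j : ℕ, (X : PowerSeries ℂ) ^ ((i + 1) * j)) (fun i ↦ by
      simp_rw [coeff_tsum_X_pow_mul i.succ_pos]
      exact summable_norm_ite_dvd_mul_pow _ hq) M
  simp_rw [← mk_card_restricted_le_eq_prod, coeff_mk, coeff_tsum_X_pow_mul (Nat.succ_pos _),
    (hasSum_ite_dvd_mul_pow (Nat.succ_pos _) hq).tsum_eq, Finset.prod_inv_distrib] at h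
  exact h

end GeneratingFunction

lemma card_restricted_le_card (n M : ℕ) :
    (Nat.Partition.restricted n (· ≤ M)).card ≤ Fintype.card (Nat.Partition n) :=
  Finset.card_le_univ _

lemma card_restricted_eq_card {n M : ℕ} (h : n ≤ M) :
    (Nat.Partition.restricted n (· ≤ M)).card = Fintype.card (Nat.Partition n) := by
  rw [Nat.Partition.restricted, Finset.filter_true_of_mem, Finset.card_univ]
  intro x _ i hi
  exact (x.le_of_mem_parts hi).trans h

lemma tendsto_prod_eulerProd {q : ℂ} (hq : ‖q‖ < 1) :
    Tendsto (fun M ↦ ∏ i ∈ Finset.range M, (1 - q ^ (i + 1))) atTop (𝓝 (eulerProd q)) :=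
  (ModularForm.multipliable_one_sub_pow hq).hasProd.tendsto_prod_nat

lemma norm_pow_succ_lt_one {q : ℂ} (hq : ‖q‖ < 1) (n : ℕ) : ‖q ^ (n + 1)‖ < 1 := by
  rw [norm_pow]
  exact pow_lt_one₀ (norm_nonneg _) hq n.succ_ne_zero

lemma one_sub_pow_succ_ne_zero {q : ℂ} (hq : ‖q‖ < 1) (n : ℕ) : 1 - q ^ (n + 1) ≠ 0 := by
  intro h
  have := norm_pow_succ_lt_one hq n
  rw [← sub_eq_zero.mp h] at this
  simp at this

lemma eulerProd_ne_zero {q : ℂ} (hq : ‖q‖ < 1) : eulerProd q ≠ 0 := by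
  simp_rw [eulerProd, sub_eq_add_neg]
  refine tprod_one_add_ne_zero_of_summable (f := fun n ↦ -q ^ (n + 1))
    (fun n ↦ by simpa [← sub_eq_add_neg] using one_sub_pow_succ_ne_zero hq n) ?_
  simpa using (summable_nat_add_iff 1).mpr (summable_geometric_of_lt_one (norm_nonneg _) hq)

lemma eulerProd_zero : eulerProd 0 = 1 := by
  simp [eulerProd]

lemma differentiableOn_eulerProd : DifferentiableOn ℂ eulerProd (Metric.ball 0 1) :=
  ModularForm.differentiableOn_tprod_one_sub_pow

lemma continuousAt_eulerProd {q : ℂ} (hq : ‖q‖ < 1) : ContinuousAt eulerProd q :=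
  (differentiableOn_eulerProd.differentiableAt
    (Metric.isOpen_ball.mem_nhds (by simpa using hq))).continuousAt

lemma summable_card_partition_mul_pow {r : ℝ} (hr0 : 0 ≤ r) (hr : r < 1) :
    Summable fun n ↦ (Fintype.card (Nat.Partition n) : ℝ) * r ^ n := by
  have hr' : ‖(r : ℂ)‖ < 1 := by simpa [abs_of_nonneg hr0] using hr
  have hlim := ((tendsto_prod_eulerProd hr').inv₀ (eulerProd_ne_zero hr')).norm.bddAbove_range
  obtain ⟨B, hB⟩ := hlim
  refine summable_of_sum_range_le (c := B) (fun n ↦ by positivity) fun m ↦ ?_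
  obtain ⟨hs, ht⟩ := summable_norm_and_tsum_card_restricted hr' m
  have hs' : Summable fun n ↦ ((Nat.Partition.restricted n (· ≤ m)).card : ℝ) * r ^ n := by
    simpa [abs_of_nonneg hr0] using hs
  have ht' : ((∑' n, ((Nat.Partition.restricted n (· ≤ m)).card : ℝ) * r ^ n : ℝ) : ℂ) =
      (∏ i ∈ Finset.range m, (1 - (r : ℂ) ^ (i + 1)))⁻¹ := by
    rw [← ht]
    push_cast
    rfl
  calc ∑ n ∈ Finset.range m, (Fintype.card (Nat.Partition n) : ℝ) * r ^ n
      = ∑ n ∈ Finset.range m, ((Nat.Partition.restricted n (· ≤ m)).card : ℝ) * r ^ n :=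
        Finset.sum_congr rfl fun n hn ↦ by
          rw [card_restricted_eq_card (Finset.mem_range.mp hn).le]
    _ ≤ ∑' n, ((Nat.Partition.restricted n (· ≤ m)).card : ℝ) * r ^ n :=
        hs'.sum_le_tsum _ fun n _ ↦ by positivity
    _ ≤ ‖((∑' n, ((Nat.Partition.restricted n (· ≤ m)).card : ℝ) * r ^ n : ℝ) : ℂ)‖ := by
        rw [Complex.norm_real]
        exact le_abs_self _
    _ ≤ B := by
        rw [ht']
        exact hB ⟨m, rfl⟩

lemma summable_norm_card_partition_mul_pow {q : ℂ} (hq : ‖q‖ < 1) :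
    Summable fun n ↦ ‖(Fintype.card (Nat.Partition n) : ℂ) * q ^ n‖ := by
  simpa using summable_card_partition_mul_pow (norm_nonneg q) hq

/-- Euler's generating function for the partition function. -/
lemma tsum_card_partition_mul_pow {q : ℂ} (hq : ‖q‖ < 1) :
    ∑' n, (Fintype.card (Nat.Partition n) : ℂ) * q ^ n = (eulerProd q)⁻¹ := by
  have hlim := (tendsto_prod_eulerProd hq).inv₀ (eulerProd_ne_zero hq)
  simp_rw [← fun M ↦ (summable_norm_and_tsum_card_restricted hq M).2] at hlim
  refine tendsto_nhds_unique (tendsto_tsum_of_dominated_convergence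
    (summable_norm_card_partition_mul_pow hq) (fun n ↦ ?_) (.of_forall fun M n ↦ ?_)) hlim
  · refine tendsto_const_nhds.congr' ?_
    filter_upwards [eventually_ge_atTop n] with M hM
    rw [card_restricted_eq_card hM]
  · rw [norm_mul, norm_mul, Complex.norm_natCast, Complex.norm_natCast]
    gcongr
    exact card_restricted_le_card n M

/-- The generating function of the partition numbers, evaluated at `exp (-s)`. -/
noncomputable def partitionGen (s : ℂ) : ℂ := (eulerProd (Complex.exp (-s)))⁻¹

lemma norm_exp_neg_lt_one {s : ℂ} (hs : 0 < s.re) : ‖Complex.exp (-s)‖ < 1 := by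
  simpa [Complex.norm_exp] using hs

lemma continuousAt_partitionGen {s : ℂ} (hs : 0 < s.re) : ContinuousAt partitionGen s :=
  ((continuousAt_eulerProd (norm_exp_neg_lt_one hs)).comp
    (f := fun s : ℂ ↦ Complex.exp (-s)) (by fun_prop)).inv₀
    (eulerProd_ne_zero (norm_exp_neg_lt_one hs))

lemma integral_exp_mul_I_eq_ite (m n : ℕ) :
    ∫ θ in (-π)..π, Complex.exp (((m : ℂ) - n) * Complex.I * θ) =
      if m = n then 2 * (π : ℂ) else 0 := by
  split_ifs with h
  · subst h
    simp
    ring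
  · have hc : ((m : ℂ) - n) * Complex.I ≠ 0 :=
      mul_ne_zero (sub_ne_zero.mpr (by exact_mod_cast h)) Complex.I_ne_zero
    rw [integral_exp_mul_complex hc, div_eq_zero_iff, sub_eq_zero]
    left
    rw [← mul_one (Complex.exp (_ * ((-π : ℝ) : ℂ))),
      ← Complex.exp_int_mul_two_pi_mul_I ((m : ℤ) - n), ← Complex.exp_add]
    congr 1
    push_cast
    ring

/-- Cauchy's coefficient formula for the partition numbers. -/
lemma card_partition_eq_integral (n : ℕ) {t : ℝ} (ht : 0 < t) :
    (Fintype.card (Nat.Partition n) : ℂ) = (2 * π : ℂ)⁻¹ *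
      ∫ θ in (-π)..π, partitionGen (t - θ * Complex.I) *
        Complex.exp (n * (t - θ * Complex.I)) := by
  have hre (θ : ℝ) : 0 < ((t : ℂ) - θ * Complex.I).re := by simpa using ht
  have hsum : HasSum
      (fun m : ℕ ↦ ∫ θ in (-π)..π, (Fintype.card (Nat.Partition m) : ℂ) *
        Complex.exp (-((t : ℂ) - θ * Complex.I)) ^ m * Complex.exp (n * (t - θ * Complex.I)))
      (∫ θ in (-π)..π, partitionGen (t - θ * Complex.I) *
        Complex.exp (n * (t - θ * Complex.I))) := by
    refine intervalIntegral.hasSum_integral_of_dominated_convergence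
      (fun m _ ↦ (Fintype.card (Nat.Partition m) : ℝ) * Real.exp (-t) ^ m * Real.exp (n * t))
      (fun m ↦ ?_) (fun m ↦ .of_forall fun θ _ ↦ ?_) (.of_forall fun θ _ ↦ ?_)
      (by simp) (.of_forall fun θ _ ↦ ?_)
    · exact Continuous.aestronglyMeasurable (by fun_prop)
    · simp [Complex.norm_exp]
    · exact (summable_card_partition_mul_pow (Real.exp_nonneg _) (by simpa using ht)).mul_right _
    · refine HasSum.mul_right _ ?_
      rw [partitionGen, ← tsum_card_partition_mul_pow (norm_exp_neg_lt_one (hre θ))]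
      exact (summable_norm_card_partition_mul_pow (norm_exp_neg_lt_one (hre θ))).of_norm.hasSum
  have hterm (m : ℕ) : ∫ θ in (-π)..π, (Fintype.card (Nat.Partition m) : ℂ) *
        Complex.exp (-((t : ℂ) - θ * Complex.I)) ^ m * Complex.exp (n * (t - θ * Complex.I)) =
      if m = n then (Fintype.card (Nat.Partition n) : ℂ) * (2 * π) else 0 := by
    have (θ : ℝ) : (Fintype.card (Nat.Partition m) : ℂ) *
        Complex.exp (-((t : ℂ) - θ * Complex.I)) ^ m * Complex.exp (n * (t - θ * Complex.I)) =
        (Fintype.card (Nat.Partition m) * Complex.exp ((n - m) * t)) *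
          Complex.exp (((m : ℂ) - n) * Complex.I * θ) := by
      rw [← Complex.exp_nat_mul, mul_assoc, mul_assoc, ← Complex.exp_add, ← Complex.exp_add]
      congr 2
      ring
    simp_rw [this]
    rw [intervalIntegral.integral_const_mul, integral_exp_mul_I_eq_ite]
    split_ifs with h
    · subst h
      simp
    · simp
  simp_rw [hterm] at hsum
  rw [hsum.unique (hasSum_ite_eq n _)]
  field_simp

/-- The modular transformation of the generating function, from that of Dedekind's eta function. -/
lemma partitionGen_eq {s : ℂ} (hs : 0 < s.re) :
    partitionGen s = (Complex.sqrt Complex.I)⁻¹ * Complex.sqrt (Complex.I * s / (2 * π)) *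
      Complex.exp (π ^ 2 / (6 * s) - s / 24) * partitionGen (4 * π ^ 2 / s) := by
  have hs0 : s ≠ 0 := by
    rintro rfl
    simp at hs
  have hpi : (π : ℂ) ≠ 0 := by exact_mod_cast pi_ne_zero
  have hz : Complex.I * s / (2 * π) ∈ UpperHalfPlane.upperHalfPlaneSet := by
    have : Complex.I * s / (2 * π) = ((2 * π)⁻¹ : ℝ) * (Complex.I * s) := by
      push_cast
      field_simp
    change 0 < (Complex.I * s / (2 * π)).im
    rw [this, Complex.im_ofReal_mul]
    have : 0 < (2 * π)⁻¹ * s.re := by positivity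
    simpa using this
  have heta (z : ℂ) : ModularForm.eta z =
      Complex.exp (2 * π * Complex.I * z / 24) *
        eulerProd (Complex.exp (2 * π * Complex.I * z)) := by
    simp only [ModularForm.eta, eulerProd, ModularForm.eta_q_eq_pow, Function.Periodic.qParam]
    norm_num
  have h := ModularForm.eta_comp_eq_csqrt_I_inv hz
  simp only [Function.comp_apply, Pi.smul_apply, Pi.mul_apply, smul_eq_mul, heta] at h
  have h1 : 2 * π * Complex.I * (Complex.I * s / (2 * π)) = -s := by
    field_simp
    simp
  have h2 : 2 * π * Complex.I * (-1 / (Complex.I * s / (2 * π))) = -(4 * π ^ 2 / s) := by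
    field_simp
    ring
  rw [h1, h2] at h
  have hre : 0 < (4 * π ^ 2 / s).re := by
    have : (4 * π ^ 2 / s) = ((4 * π ^ 2 : ℝ) : ℂ) * s⁻¹ := by
      push_cast
      field_simp
    rw [this, Complex.re_ofReal_mul, Complex.inv_re]
    have := Complex.normSq_pos.mpr hs0
    positivity
  have hE1 := eulerProd_ne_zero (norm_exp_neg_lt_one hs)
  have hE2 := eulerProd_ne_zero (norm_exp_neg_lt_one hre)
  have hexp : Complex.exp (π ^ 2 / (6 * s) - s / 24) =
      Complex.exp (-s / 24) * (Complex.exp (-(4 * π ^ 2 / s) / 24))⁻¹ := by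
    rw [← Complex.exp_neg, ← Complex.exp_add]
    congr 1
    field_simp
    ring
  rw [partitionGen, partitionGen, hexp]
  field_simp at h ⊢
  linear_combination h

lemma norm_one_sub_exp_sq (a φ : ℝ) :
    ‖1 - Complex.exp (-((a : ℂ) - φ * Complex.I))‖ ^ 2 =
      (1 - Real.exp (-a)) ^ 2 + 4 * Real.exp (-a) * Real.sin (φ / 2) ^ 2 := by
  have h : Complex.exp (-((a : ℂ) - φ * Complex.I)) =
      ⟨Real.exp (-a) * Real.cos φ, Real.exp (-a) * Real.sin φ⟩ := by
    apply Complex.ext <;> simp [Complex.exp_re, Complex.exp_im]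
  have hcos : Real.cos φ = 1 - 2 * Real.sin (φ / 2) ^ 2 := by
    have h1 := Real.cos_two_mul (φ / 2)
    have h2 := Real.sin_sq_add_cos_sq (φ / 2)
    rw [mul_div_cancel₀ φ two_ne_zero] at h1
    linarith
  rw [← Complex.normSq_eq_norm_sq, Complex.normSq_apply, h]
  simp only [Complex.sub_re, Complex.one_re, Complex.sub_im, Complex.one_im]
  have h3 : Real.sin φ ^ 2 = 1 - Real.cos φ ^ 2 := by
    linarith [Real.sin_sq_add_cos_sq φ]
  linear_combination Real.exp (-a) ^ 2 * h3 - 2 * Real.exp (-a) * hcos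

lemma one_sub_exp_sq_mul_le_norm_one_sub_exp_sq {a : ℝ} (ha : 0 < a) (ha1 : a ≤ 1) (φ : ℝ) :
    (1 - Real.exp (-a)) ^ 2 * (1 + Real.sin (φ / 2) ^ 2 / a ^ 2) ≤
      ‖1 - Complex.exp (-((a : ℂ) - φ * Complex.I))‖ ^ 2 := by
  rw [norm_one_sub_exp_sq, mul_add, mul_one, add_le_add_iff_left, mul_div_assoc', mul_comm,
    mul_div_assoc, mul_comm]
  gcongr
  have h1 : 1 - Real.exp (-a) ≤ a := by linarith [Real.add_one_le_exp (-a)]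
  have h0 : 0 ≤ 1 - Real.exp (-a) := by simpa using ha.le
  have h4 : 1 ≤ 4 * Real.exp (-a) := by
    have := Real.exp_le_exp.mpr (neg_le_neg ha1)
    have h3 : Real.exp 1 < 3 := Real.exp_one_lt_three
    rw [Real.exp_neg 1] at this
    have h5 : (3 : ℝ)⁻¹ ≤ (Real.exp 1)⁻¹ := by gcongr
    linarith
  refine le_trans ?_ h4
  rw [div_le_one (by positivity)]
  gcongr

lemma norm_partitionGen_sq_mul_prod_le {t : ℝ} (ht : 0 < t) (θ : ℝ) {K : ℕ} (hK : K * t ≤ 1) :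
    ‖partitionGen (t - θ * Complex.I)‖ ^ 2 *
      ∏ k ∈ Finset.range K, (1 + Real.sin ((k + 1) * θ / 2) ^ 2 / ((k + 1) * t) ^ 2) ≤
    ‖partitionGen t‖ ^ 2 := by
  set x : ℕ → ℝ := fun k ↦ Real.sin ((k + 1) * θ / 2) ^ 2 / ((k + 1) * t) ^ 2 with hx
  have hq : ‖Complex.exp (-((t : ℂ) - θ * Complex.I))‖ < 1 := norm_exp_neg_lt_one (by simpa)
  have hr : ‖Complex.exp (-(t : ℂ))‖ < 1 := norm_exp_neg_lt_one (by simpa)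
  have key : ‖eulerProd (Complex.exp (-(t : ℂ)))‖ ^ 2 * ∏ k ∈ Finset.range K, (1 + x k) ≤
      ‖eulerProd (Complex.exp (-((t : ℂ) - θ * Complex.I)))‖ ^ 2 := by
    refine le_of_tendsto_of_tendsto
      (((tendsto_prod_eulerProd hr).norm.pow 2).mul_const _)
      ((tendsto_prod_eulerProd hq).norm.pow 2) ?_
    filter_upwards [eventually_ge_atTop K] with M hM
    have hsplit : ∏ k ∈ Finset.range K, (1 + x k) =
        ∏ k ∈ Finset.range M, if k < K then 1 + x k else 1 := by
      rw [← Finset.prod_subset (Finset.range_mono hM)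
        fun k _ hk ↦ if_neg fun h ↦ hk (Finset.mem_range.mpr h)]
      exact Finset.prod_congr rfl fun k hk ↦ (if_pos (Finset.mem_range.mp hk)).symm
    rw [hsplit, norm_prod, norm_prod, ← Finset.prod_pow, ← Finset.prod_pow,
      ← Finset.prod_mul_distrib]
    refine Finset.prod_le_prod (fun k _ ↦ ?_) fun k _ ↦ ?_
    · have : 0 ≤ x k := by positivity
      split_ifs <;> positivity
    · have e1 : Complex.exp (-(t : ℂ)) ^ (k + 1) = (Real.exp (-((k + 1) * t)) : ℂ) := by
        rw [← Complex.exp_nat_mul]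
        push_cast
        congr 1
        ring
      have e2 : Complex.exp (-((t : ℂ) - θ * Complex.I)) ^ (k + 1) =
          Complex.exp (-((((k + 1) * t : ℝ) : ℂ) - ((k + 1) * θ : ℝ) * Complex.I)) := by
        rw [← Complex.exp_nat_mul]
        push_cast
        congr 1
        ring
      have e3 : ‖1 - (Real.exp (-((k + 1) * t)) : ℂ)‖ ^ 2 =
          (1 - Real.exp (-((k + 1) * t))) ^ 2 := by
        rw [← Complex.ofReal_one, ← Complex.ofReal_sub, Complex.norm_real, Real.norm_eq_abs,
          sq_abs]
      rw [e1, e2, e3]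
      split_ifs with hk
      · refine one_sub_exp_sq_mul_le_norm_one_sub_exp_sq (by positivity) (le_trans ?_ hK) _
        gcongr
        exact_mod_cast hk
      · rw [norm_one_sub_exp_sq, mul_one, le_add_iff_nonneg_right]
        positivity
  have h1 : 0 < ‖eulerProd (Complex.exp (-(t : ℂ)))‖ := norm_pos_iff.mpr (eulerProd_ne_zero hr)
  have h2 : 0 < ‖eulerProd (Complex.exp (-((t : ℂ) - θ * Complex.I)))‖ :=
    norm_pos_iff.mpr (eulerProd_ne_zero hq)
  rw [partitionGen, partitionGen, norm_inv, norm_inv, inv_pow, inv_pow, inv_mul_eq_div,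
    div_le_iff₀ (by positivity), inv_mul_eq_div, le_div_iff₀ (by positivity), mul_comm]
  exact key

lemma sum_sin_sq (θ : ℝ) (K : ℕ) :
    4 * Real.sin (θ / 2) * ∑ k ∈ Finset.range K, Real.sin ((k + 1) * θ / 2) ^ 2 =
      2 * K * Real.sin (θ / 2) - (Real.sin ((K + 1 / 2) * θ) - Real.sin (θ / 2)) := by
  induction K with
  | zero => simp [show 2⁻¹ * θ = θ / 2 by ring]
  | succ K ih =>
    rw [Finset.sum_range_succ, mul_add, ih]
    have h1 : Real.sin ((K + 1) * θ + θ / 2) - Real.sin ((K + 1) * θ - θ / 2) =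
        2 * Real.sin (θ / 2) * Real.cos ((K + 1) * θ) := by
      rw [Real.sin_add, Real.sin_sub]
      ring
    have h2 : Real.cos ((K + 1) * θ) = 1 - 2 * Real.sin ((K + 1) * θ / 2) ^ 2 := by
      have h1 := Real.cos_two_mul ((K + 1) * θ / 2)
      have h2 := Real.sin_sq_add_cos_sq ((K + 1) * θ / 2)
      rw [mul_div_cancel₀ _ two_ne_zero] at h1
      linarith
    rw [show ((K + 1) * θ + θ / 2 : ℝ) = (((K + 1 : ℕ) : ℝ) + 1 / 2) * θ by push_cast; ring,
      show ((K + 1) * θ - θ / 2 : ℝ) = (K + 1 / 2) * θ by ring] at h1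
    push_cast at h1 ⊢
    linear_combination h1 + 2 * Real.sin (θ / 2) * h2

lemma exp_half_le_one_add {s : ℝ} (h0 : 0 ≤ s) (h1 : s ≤ 1) : Real.exp (s / 2) ≤ 1 + s := by
  have h := Real.add_one_le_exp (-(s / 2))
  rw [Real.exp_neg] at h
  have hpos := Real.exp_pos (s / 2)
  have h2 : (1 - s / 2) * Real.exp (s / 2) ≤ 1 := by
    calc (1 - s / 2) * Real.exp (s / 2) ≤ (Real.exp (s / 2))⁻¹ * Real.exp (s / 2) := by
          gcongr
          linarith
      _ = 1 := inv_mul_cancel₀ hpos.ne'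
  nlinarith

lemma floor_inv_two_mul_bounds {t : ℝ} (ht : 0 < t) (ht2 : t ≤ 1 / 2) :
    1 / (4 * t) ≤ (⌊1 / (2 * t)⌋₊ : ℝ) ∧ 1 / (2 * t) - 1 ≤ (⌊1 / (2 * t)⌋₊ : ℝ) ∧
      ((2 * ⌊1 / (2 * t)⌋₊ : ℕ) : ℝ) * t ≤ 1 := by
  have h1 : 1 ≤ 1 / (2 * t) := by
    rw [le_div_iff₀ (by positivity)]
    linarith
  have h2 := Nat.sub_one_lt_floor (1 / (2 * t))
  have h3 : (⌊1 / (2 * t)⌋₊ : ℝ) ≤ 1 / (2 * t) := Nat.floor_le (by positivity)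
  have h4 : (1 : ℝ) ≤ (⌊1 / (2 * t)⌋₊ : ℝ) := by exact_mod_cast (Nat.one_le_floor_iff _).mpr h1
  have h5 : 1 / (2 * t) = 2 * (1 / (4 * t)) := by field_simp; norm_num
  refine ⟨by linarith, h2.le, ?_⟩
  rw [le_div_iff₀ (by positivity)] at h3
  push_cast
  linarith

lemma sq_le_prod_of_abs_le {t θ : ℝ} (ht : 0 < t) (ht2 : t ≤ 1 / 2) (hθ : |θ| ≤ π * t) :
    (1 + (θ / t) ^ 2 / (4 * π ^ 2 * t)) ^ 2 ≤
      ∏ k ∈ Finset.range (2 * ⌊1 / (2 * t)⌋₊),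
        (1 + Real.sin ((k + 1) * θ / 2) ^ 2 / ((k + 1) * t) ^ 2) := by
  obtain ⟨hL, -, hK⟩ := floor_inv_two_mul_bounds ht ht2
  set L := ⌊1 / (2 * t)⌋₊
  have hpi := Real.pi_pos
  calc (1 + (θ / t) ^ 2 / (4 * π ^ 2 * t)) ^ 2
      = (1 + 1 / (4 * t) * ((θ / t) ^ 2 / π ^ 2)) ^ 2 := by
        congr 2
        field_simp
    _ ≤ (1 + L * ((θ / t) ^ 2 / π ^ 2)) ^ 2 := by gcongr
    _ ≤ ((1 + (θ / t) ^ 2 / π ^ 2) ^ L) ^ 2 := by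
        gcongr
        have : 0 ≤ (θ / t) ^ 2 / π ^ 2 := by positivity
        exact one_add_mul_le_pow (by linarith) L
    _ = ∏ k ∈ Finset.range (2 * L), (1 + (θ / t) ^ 2 / π ^ 2) := by
        rw [Finset.prod_const, Finset.card_range, mul_comm 2 L, pow_mul]
    _ ≤ _ := by
        refine Finset.prod_le_prod (fun _ _ ↦ by positivity) fun k hk ↦ ?_
        have hk' : ((k : ℝ) + 1) * t ≤ 1 := by
          refine le_trans ?_ hK
          gcongr
          exact_mod_cast Finset.mem_range.mp hk
        have habs : |(k + 1) * θ / 2| = (k + 1) * |θ| / 2 := by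
          rw [abs_div, abs_mul, abs_of_pos (by positivity : (0 : ℝ) < k + 1), abs_two]
        have hsin := Real.mul_abs_le_abs_sin (x := (k + 1) * θ / 2) (by
          rw [habs]
          have : ((k : ℝ) + 1) * |θ| ≤ (k + 1) * (π * t) := by gcongr
          nlinarith)
        rw [habs] at hsin
        have hsq : ((k + 1) * |θ| / π) ^ 2 ≤ Real.sin ((k + 1) * θ / 2) ^ 2 := by
          rw [← sq_abs (Real.sin _)]
          gcongr
          refine le_of_eq_of_le ?_ hsin
          field_simp
        have e : (θ / t) ^ 2 / π ^ 2 = ((k + 1) * |θ| / π) ^ 2 / ((k + 1) * t) ^ 2 := by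
          rw [div_pow ((k + 1) * |θ|), mul_pow _ |θ|, sq_abs]
          field_simp
        rw [e]
        gcongr

lemma exp_le_prod_of_le_abs {t θ : ℝ} (ht : 0 < t) (ht2 : t ≤ 1 / 2) (hθ : π * t ≤ |θ|)
    (hθ' : |θ| ≤ π) :
    Real.exp ((1 / (4 * t) - 1) / 2) ≤
      ∏ k ∈ Finset.range (2 * ⌊1 / (2 * t)⌋₊),
        (1 + Real.sin ((k + 1) * θ / 2) ^ 2 / ((k + 1) * t) ^ 2) := by
  obtain ⟨-, hL, hK⟩ := floor_inv_two_mul_bounds ht ht2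
  set L := ⌊1 / (2 * t)⌋₊
  have hpi := Real.pi_pos
  have hsin : t ≤ Real.sin (|θ| / 2) := by
    refine le_trans ?_ (Real.mul_le_sin (by positivity) (by linarith))
    rw [← mul_le_mul_iff_right₀ hpi]
    field_simp
    exact hθ
  have hspos : 0 < Real.sin (|θ| / 2) := ht.trans_le hsin
  have habs (k : ℕ) : Real.sin ((k + 1) * |θ| / 2) ^ 2 = Real.sin ((k + 1) * θ / 2) ^ 2 := by
    rcases abs_cases θ with ⟨h, -⟩ | ⟨h, -⟩ <;> rw [h]
    rw [show ((k : ℝ) + 1) * -θ / 2 = -((k + 1) * θ / 2) by ring, Real.sin_neg, neg_sq]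
  have hS : 1 / (4 * t) - 1 ≤ ∑ k ∈ Finset.range (2 * L), Real.sin ((k + 1) * θ / 2) ^ 2 := by
    have h := sum_sin_sq |θ| (2 * L)
    simp_rw [habs] at h
    set S := ∑ k ∈ Finset.range (2 * L), Real.sin ((k + 1) * θ / 2) ^ 2
    set s := Real.sin (|θ| / 2)
    have h1 := Real.sin_le_one ((((2 * L : ℕ) : ℝ) + 1 / 2) * |θ|)
    push_cast at h h1
    have h2 : (L : ℝ) - 1 / (4 * s) ≤ S := by
      rw [sub_le_iff_le_add, ← mul_le_mul_iff_right₀ (by positivity : 0 < 4 * s), mul_add,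
        mul_one_div_cancel (by positivity)]
      linarith
    have h3 : 1 / (4 * s) ≤ 1 / (4 * t) := by gcongr
    have h4 : 1 / (2 * t) = 2 * (1 / (4 * t)) := by field_simp; norm_num
    linarith
  calc Real.exp ((1 / (4 * t) - 1) / 2)
      ≤ Real.exp ((∑ k ∈ Finset.range (2 * L), Real.sin ((k + 1) * θ / 2) ^ 2) / 2) := by gcongr
    _ = ∏ k ∈ Finset.range (2 * L), Real.exp (Real.sin ((k + 1) * θ / 2) ^ 2 / 2) := by
        rw [← Real.exp_sum, Finset.sum_div]
    _ ≤ _ := by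
        refine Finset.prod_le_prod (fun _ _ ↦ by positivity) fun k hk ↦ ?_
        have hk' : ((k : ℝ) + 1) * t ≤ 1 := by
          refine le_trans ?_ hK
          gcongr
          exact_mod_cast Finset.mem_range.mp hk
        refine (exp_half_le_one_add (sq_nonneg _) (Real.sin_sq_le_one _)).trans ?_
        gcongr
        refine le_div_self (sq_nonneg _) (by positivity) (pow_le_one₀ (by positivity) hk')

lemma eventually_sq_le_exp_inv :
    ∀ᶠ t : ℝ in 𝓝[>] 0, (1 + 1 / (4 * t ^ 3)) ^ 2 ≤ Real.exp ((1 / (4 * t) - 1) / 2) := by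
  have hlim : Tendsto (fun x : ℝ ↦ (1 + x ^ 3 / 4) ^ 2 / Real.exp ((x / 4 - 1) / 2))
      atTop (𝓝 0) := by
    have h (n : ℕ) := (Real.tendsto_pow_mul_exp_neg_atTop_nhds_zero n).comp
      (tendsto_id.atTop_div_const (by norm_num : (0 : ℝ) < 8))
    have := (((h 0).add ((h 3).const_mul 256)).add ((h 6).const_mul 16384)).const_mul
      (Real.exp (1 / 2))
    simp only [mul_zero, add_zero] at this
    refine this.congr fun x ↦ ?_
    simp only [Function.comp_apply, id_eq]
    rw [show (x / 4 - 1) / 2 = -(1 / 2) + x / 8 by ring, Real.exp_add, Real.exp_neg, Real.exp_neg]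
    field_simp
    ring
  filter_upwards [tendsto_inv_nhdsGT_zero.eventually (hlim.eventually_le_const one_pos),
    self_mem_nhdsWithin] with t h ht
  have ht : 0 < t := ht
  rw [div_le_one (Real.exp_pos _)] at h
  convert! h using 3
  · field_simp
  · field_simp

/-- Decay of the generating function away from the real axis. -/
lemma eventually_norm_partitionGen_mul_le :
    ∀ᶠ t : ℝ in 𝓝[>] 0, ∀ θ : ℝ, |θ| ≤ π →
      ‖partitionGen (t - θ * Complex.I)‖ * (1 + (θ / t) ^ 2 / (4 * π ^ 2 * t)) ≤
        ‖partitionGen t‖ := by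
  filter_upwards [eventually_sq_le_exp_inv, self_mem_nhdsWithin,
    eventually_nhdsWithin_of_eventually_nhds (eventually_le_nhds (by norm_num : (0 : ℝ) < 1 / 2))]
    with t hexp ht ht2 θ hθ
  have ht : 0 < t := ht
  have hpi := Real.pi_pos
  refine (pow_le_pow_iff_left₀ (by positivity) (norm_nonneg _) two_ne_zero).mp ?_
  refine le_trans ?_
    (norm_partitionGen_sq_mul_prod_le ht θ (floor_inv_two_mul_bounds ht ht2).2.2)
  rw [mul_pow]
  gcongr
  rcases le_total |θ| (π * t) with h | h
  · exact sq_le_prod_of_abs_le ht ht2 h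
  · refine le_trans ?_ (hexp.trans (exp_le_prod_of_le_abs ht ht2 h hθ))
    have : (θ / t) ^ 2 / (4 * π ^ 2 * t) ≤ 1 / (4 * t ^ 3) := by
      rw [div_pow, ← sq_abs θ]
      calc |θ| ^ 2 / t ^ 2 / (4 * π ^ 2 * t) ≤ π ^ 2 / t ^ 2 / (4 * π ^ 2 * t) := by gcongr
        _ = 1 / (4 * t ^ 3) := by field_simp
    gcongr

lemma Complex.sqrt_ofReal_mul {x : ℝ} (hx : 0 < x) {z : ℂ} (hz : z ≠ 0) :
    Complex.sqrt (x * z) = (√x : ℝ) * Complex.sqrt z := by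
  have hx' : (x : ℂ) ≠ 0 := by exact_mod_cast hx.ne'
  rw [Real.sqrt_eq_rpow, Complex.ofReal_cpow hx.le]
  simp only [Complex.sqrt]
  rw [Complex.cpow_def_of_ne_zero (mul_ne_zero hx' hz), Complex.log_ofReal_mul hx hz,
    Complex.cpow_def_of_ne_zero hx', Complex.cpow_def_of_ne_zero hz, ← Complex.exp_add,
    Complex.ofReal_log hx.le]
  congr 1
  push_cast
  ring

/-- The point of the line `re w = 1` reached from the saddle point `1` after rescaling. -/
noncomputable def saddlePath (t u : ℝ) : ℂ := 1 - (u * √(6 * t) / π : ℝ) * Complex.I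

/-- The rescaled integrand of Cauchy's formula for the partition numbers. -/
noncomputable def saddleIntegrand (t u : ℝ) : ℂ :=
  partitionGen (t * saddlePath t u) *
    Complex.exp ((π ^ 2 / (6 * t) : ℝ) * (saddlePath t u - 2)) / (√(t / (2 * π)) : ℝ)

lemma saddlePath_re (t u : ℝ) : (saddlePath t u).re = 1 := by
  simp [saddlePath]

lemma saddlePath_ne_zero (t u : ℝ) : saddlePath t u ≠ 0 := fun h ↦ by
  have := saddlePath_re t u
  simp [h] at this

lemma continuous_saddlePath : Continuous fun p : ℝ × ℝ ↦ saddlePath p.1 p.2 := by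
  unfold saddlePath
  fun_prop

lemma tendsto_saddlePath (u : ℝ) : Tendsto (fun t ↦ saddlePath t u) (𝓝[>] 0) (𝓝 1) := by
  have h : Tendsto (fun t ↦ saddlePath t u) (𝓝 0) (𝓝 (saddlePath 0 u)) :=
    (continuous_saddlePath.comp (by fun_prop : Continuous fun t : ℝ ↦ (t, u))).tendsto 0
  simpa [saddlePath] using h.mono_left nhdsWithin_le_nhds

lemma mul_saddlePath_re_pos {t : ℝ} (ht : 0 < t) (u : ℝ) : 0 < (t * saddlePath t u).re := by
  simpa [saddlePath_re] using ht

lemma saddleIntegrand_eq {t : ℝ} (ht : 0 < t) (u : ℝ) :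
    saddleIntegrand t u = (Complex.sqrt Complex.I)⁻¹ *
      Complex.sqrt (Complex.I * saddlePath t u) * Complex.exp (-(t * saddlePath t u / 24)) *
        Complex.exp (-(u ^ 2 / saddlePath t u)) *
          partitionGen (4 * π ^ 2 / (t * saddlePath t u)) := by
  have hw := saddlePath_ne_zero t u
  have ht' : (t : ℂ) ≠ 0 := by exact_mod_cast ht.ne'
  have hpi : (π : ℂ) ≠ 0 := by exact_mod_cast pi_ne_zero
  have hsq : (saddlePath t u - 1) ^ 2 = -(6 * t * u ^ 2 / π ^ 2) := by
    have h6 : ((√(6 * t) : ℝ) : ℂ) ^ 2 = 6 * t := by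
      rw [← Complex.ofReal_pow, Real.sq_sqrt (by positivity)]
      push_cast
      rfl
    rw [saddlePath]
    push_cast
    linear_combination (u ^ 2 / π ^ 2 : ℂ) * Complex.I ^ 2 * h6 +
      6 * t * (u ^ 2 / π ^ 2 : ℂ) * Complex.I_sq
  have hsqrt : Complex.sqrt (Complex.I * (t * saddlePath t u) / (2 * π)) =
      (√(t / (2 * π)) : ℝ) * Complex.sqrt (Complex.I * saddlePath t u) := by
    rw [← Complex.sqrt_ofReal_mul (by positivity) (mul_ne_zero Complex.I_ne_zero hw)]
    congr 1
    push_cast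
    ring
  have hs : ((√(t / (2 * π)) : ℝ) : ℂ) ≠ 0 := by
    have : 0 < √(t / (2 * π)) := by positivity
    exact_mod_cast this.ne'
  have hexp : Complex.exp (π ^ 2 / (6 * (t * saddlePath t u)) - t * saddlePath t u / 24) *
      Complex.exp ((π ^ 2 / (6 * t) : ℝ) * (saddlePath t u - 2)) =
      Complex.exp (-(t * saddlePath t u / 24)) * Complex.exp (-(u ^ 2 / saddlePath t u)) := by
    rw [← Complex.exp_add, ← Complex.exp_add]
    congr 1
    have : (π ^ 2 / (6 * (t * saddlePath t u)) : ℂ) +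
        (π ^ 2 / (6 * t)) * (saddlePath t u - 2) = -(u ^ 2 / saddlePath t u) := by
      trans (π ^ 2 / (6 * t)) * (saddlePath t u - 1) ^ 2 / saddlePath t u
      · field_simp
        ring
      · rw [hsq]
        field_simp
    push_cast
    linear_combination this
  rw [saddleIntegrand, partitionGen_eq (mul_saddlePath_re_pos ht u), hsqrt, div_eq_iff hs]
  linear_combination (Complex.sqrt Complex.I)⁻¹ * (√(t / (2 * π)) : ℝ) *
    Complex.sqrt (Complex.I * saddlePath t u) *
      partitionGen (4 * π ^ 2 / (t * saddlePath t u)) * hexp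

lemma tendsto_partitionGen_dual (u : ℝ) :
    Tendsto (fun t : ℝ ↦ partitionGen (4 * π ^ 2 / (t * saddlePath t u))) (𝓝[>] 0) (𝓝 1) := by
  have hre : Tendsto (fun t : ℝ ↦ (4 * π ^ 2 / (t * saddlePath t u)).re) (𝓝[>] 0) atTop := by
    have h1 : Tendsto (fun t : ℝ ↦ ((saddlePath t u)⁻¹).re) (𝓝[>] 0) (𝓝 1) := by
      have h := (Complex.continuous_re.tendsto _).comp ((tendsto_saddlePath u).inv₀ one_ne_zero)
      rw [inv_one, Complex.one_re] at h
      exact h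
    have h2 : Tendsto (fun t : ℝ ↦ 4 * π ^ 2 * t⁻¹) (𝓝[>] 0) atTop :=
      tendsto_inv_nhdsGT_zero.const_mul_atTop (by positivity)
    refine (h2.atTop_mul_pos one_pos h1).congr fun t ↦ ?_
    rw [← Complex.re_ofReal_mul]
    push_cast
    congr 1
    rw [div_eq_mul_inv, mul_inv, mul_assoc]
  have hexp : Tendsto (fun t : ℝ ↦ Complex.exp (-(4 * π ^ 2 / (t * saddlePath t u))))
      (𝓝[>] 0) (𝓝 0) := by
    rw [tendsto_zero_iff_norm_tendsto_zero]
    simp_rw [Complex.norm_exp, Complex.neg_re]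
    exact Real.tendsto_exp_neg_atTop_nhds_zero.comp hre
  have h := ((continuousAt_eulerProd (q := 0) (by simp)).tendsto.comp hexp).inv₀
    (eulerProd_ne_zero (by simp))
  rw [eulerProd_zero, inv_one] at h
  exact h

lemma tendsto_saddleIntegrand (u : ℝ) :
    Tendsto (fun t ↦ saddleIntegrand t u) (𝓝[>] 0) (𝓝 (Real.exp (-u ^ 2) : ℝ)) := by
  have hw := tendsto_saddlePath u
  have ht : Tendsto (fun t : ℝ ↦ (t : ℂ)) (𝓝[>] 0) (𝓝 0) := by
    simpa using (Complex.continuous_ofReal.tendsto 0).mono_left nhdsWithin_le_nhds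
  have hsqrt : Tendsto (fun t ↦ Complex.sqrt (Complex.I * saddlePath t u)) (𝓝[>] 0)
      (𝓝 (Complex.sqrt Complex.I)) := by
    have := hw.const_mul Complex.I
    rw [mul_one] at this
    exact (Complex.continuousAt_sqrt (z := Complex.I) (by simp)).tendsto.comp this
  have hI : Complex.sqrt Complex.I ≠ 0 := by simp [Complex.sqrt]
  have hexp1 := (Complex.continuous_exp.tendsto _).comp ((ht.mul hw).div_const 24).neg
  have hexp2 := (Complex.continuous_exp.tendsto _).comp
    ((tendsto_const_nhds (x := (u : ℂ) ^ 2)).div hw one_ne_zero).neg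
  have h := (((hsqrt.const_mul (Complex.sqrt Complex.I)⁻¹).mul hexp1).mul hexp2).mul
    (tendsto_partitionGen_dual u)
  simp only [inv_mul_cancel₀ hI, zero_div, neg_zero, Complex.exp_zero, one_mul, mul_one,
    div_one] at h
  push_cast
  refine h.congr' ?_
  filter_upwards [self_mem_nhdsWithin] with t ht
  exact (saddleIntegrand_eq ht u).symm

lemma norm_saddleIntegrand (t u : ℝ) :
    ‖saddleIntegrand t u‖ = ‖partitionGen (t * saddlePath t u)‖ *
      (Real.exp (-(π ^ 2 / (6 * t))) / √(t / (2 * π))) := by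
  rw [saddleIntegrand, norm_div, norm_mul, Complex.norm_exp, Complex.re_ofReal_mul,
    Complex.norm_real, Real.norm_eq_abs, abs_of_nonneg (Real.sqrt_nonneg _), Complex.sub_re,
    saddlePath_re, Complex.re_ofNat, mul_div_assoc]
  norm_num

lemma eventually_norm_saddleIntegrand_le :
    ∀ᶠ t : ℝ in 𝓝[>] 0, ∀ u : ℝ, |t * √(6 * t) / π * u| ≤ π →
      ‖saddleIntegrand t u‖ ≤ 2 * (1 + (√(3 / (2 * π ^ 4)) * u) ^ 2)⁻¹ := by
  have h0 : ∀ᶠ t : ℝ in 𝓝[>] 0, ‖saddleIntegrand t 0‖ ≤ 2 := by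
    have := (tendsto_saddleIntegrand 0).norm
    exact this.eventually_le_const (by simp)
  filter_upwards [eventually_norm_partitionGen_mul_le, h0, self_mem_nhdsWithin] with t h h0 ht u hu
  have ht : 0 < t := ht
  have hpi := Real.pi_pos
  have h1 := h _ hu
  have e1 : (t : ℂ) - (t * √(6 * t) / π * u : ℝ) * Complex.I = t * saddlePath t u := by
    rw [saddlePath]
    push_cast
    ring
  have e2 : (t * √(6 * t) / π * u / t) ^ 2 / (4 * π ^ 2 * t) =
      (√(3 / (2 * π ^ 4)) * u) ^ 2 := by
    have : t * √(6 * t) / π * u / t = √(6 * t) * (u / π) := by field_simp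
    rw [this, mul_pow, mul_pow, Real.sq_sqrt (by positivity), Real.sq_sqrt (by positivity)]
    field_simp
    ring
  rw [e1, e2] at h1
  rw [← div_eq_mul_inv, le_div_iff₀ (by positivity)]
  refine le_trans ?_ h0
  rw [norm_saddleIntegrand, norm_saddleIntegrand, mul_right_comm]
  refine mul_le_mul_of_nonneg_right ?_ (by positivity)
  simpa [saddlePath] using h1

open MeasureTheory in
lemma tendsto_integral_saddleIntegrand :
    Tendsto (fun t : ℝ ↦ ∫ u in (-(π / (t * √(6 * t) / π)))..(π / (t * √(6 * t) / π)),
      saddleIntegrand t u) (𝓝[>] 0) (𝓝 (√π : ℝ)) := by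
  set c : ℝ → ℝ := fun t ↦ t * √(6 * t) / π with hc
  have hpi := Real.pi_pos
  have hcpos {t : ℝ} (ht : 0 < t) : 0 < c t := by positivity
  have hgauss : ∫ u : ℝ, ((Real.exp (-u ^ 2) : ℝ) : ℂ) = (√π : ℝ) := by
    rw [integral_complex_ofReal]
    simpa using congrArg (fun x : ℝ ↦ (x : ℂ)) (integral_gaussian 1)
  rw [← hgauss]
  have hlim : Tendsto (fun t : ℝ ↦ ∫ u : ℝ,
      (Set.Ioc (-(π / c t)) (π / c t)).indicator (saddleIntegrand t) u) (𝓝[>] 0)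
      (𝓝 (∫ u : ℝ, ((Real.exp (-u ^ 2) : ℝ) : ℂ))) := by
    refine tendsto_integral_filter_of_dominated_convergence
      (fun u ↦ 2 * (1 + (√(3 / (2 * π ^ 4)) * u) ^ 2)⁻¹) ?_ ?_ ?_ ?_
    · filter_upwards [self_mem_nhdsWithin] with t ht
      have hcont : Continuous (saddleIntegrand t) := by
        have hw : Continuous (saddlePath t) :=
          continuous_saddlePath.comp (by fun_prop : Continuous fun u : ℝ ↦ (t, u))
        have hG : Continuous fun u ↦ partitionGen (t * saddlePath t u) :=
          continuous_iff_continuousAt.mpr fun u ↦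
            (continuousAt_partitionGen (mul_saddlePath_re_pos ht u)).comp
              (f := fun u ↦ (t : ℂ) * saddlePath t u) (by fun_prop)
        unfold saddleIntegrand
        fun_prop
      exact hcont.aestronglyMeasurable.indicator measurableSet_Ioc
    · filter_upwards [eventually_norm_saddleIntegrand_le, self_mem_nhdsWithin] with t h ht
      refine .of_forall fun u ↦ ?_
      by_cases hu : u ∈ Set.Ioc (-(π / c t)) (π / c t)
      · rw [Set.indicator_of_mem hu]
        refine h u ?_
        change |c t * u| ≤ π
        rw [abs_mul, abs_of_pos (hcpos ht), ← le_div_iff₀' (hcpos ht)]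
        exact abs_le.mpr ⟨hu.1.le, hu.2⟩
      · rw [Set.indicator_of_notMem hu, norm_zero]
        positivity
    · exact (integrable_inv_one_add_sq.comp_mul_left' (by positivity)).const_mul 2
    · refine .of_forall fun u ↦ ?_
      refine (tendsto_saddleIntegrand u).congr' ?_
      have hc0 : Tendsto (fun t ↦ c t * |u|) (𝓝[>] 0) (𝓝 0) := by
        have : Continuous fun t ↦ c t * |u| := by fun_prop
        simpa [hc] using (this.tendsto 0).mono_left nhdsWithin_le_nhds
      filter_upwards [hc0.eventually_lt_const hpi, self_mem_nhdsWithin] with t h ht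
      rw [Set.indicator_of_mem]
      rw [← lt_div_iff₀' (hcpos ht), abs_lt] at h
      exact ⟨h.1, h.2.le⟩
  refine hlim.congr' ?_
  filter_upwards [self_mem_nhdsWithin] with t ht
  have h : 0 < π / c t := div_pos hpi (hcpos ht)
  have hle : -(π / c t) ≤ π / c t := by linarith
  rw [integral_indicator measurableSet_Ioc, intervalIntegral.integral_of_le hle]

lemma card_partition_eq_integral_saddleIntegrand {n : ℕ} (hn : 0 < n) {t : ℝ}
    (ht : t = π / √(6 * n)) :
    (Fintype.card (Nat.Partition n) : ℂ) =
      (Real.exp (π * √(2 * n / 3)) / (4 * n * √3) / √π : ℝ) *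
        ∫ u in (-(π / (t * √(6 * t) / π)))..(π / (t * √(6 * t) / π)), saddleIntegrand t u := by
  have hpi := Real.pi_pos
  have hn' : (0 : ℝ) < n := by exact_mod_cast hn
  have ht0 : 0 < t := ht ▸ by positivity
  have ht2 : t ^ 2 * (6 * n) = π ^ 2 := by
    rw [ht, div_pow, Real.sq_sqrt (by positivity)]
    field_simp
  have hnt : n * t = π ^ 2 / (6 * t) := by
    rw [← ht2]
    field_simp
  have hexp : π * √(2 * n / 3) = 2 * (n * t) := by
    rw [← Real.sqrt_sq (by positivity : 0 ≤ 2 * (n * t)), ← Real.sqrt_sq hpi.le,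
      ← Real.sqrt_mul (sq_nonneg _), ← ht2]
    congr 1
    ring
  set c : ℝ := t * √(6 * t) / π with hc
  have hc0 : 0 < c := by positivity
  have hs : 0 < √(t / (2 * π)) := by positivity
  have hconst : (2 * π)⁻¹ * (c * √(t / (2 * π))) = 1 / (4 * n * √3) / √π := by
    rw [← pow_left_inj₀ (by positivity) (by positivity) two_ne_zero, hc]
    simp only [mul_pow, div_pow, inv_pow, one_pow]
    rw [Real.sq_sqrt (by positivity), Real.sq_sqrt (by positivity), Real.sq_sqrt (by positivity),
      Real.sq_sqrt hpi.le]
    field_simp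
    have h4 : t ^ 4 * (36 * n ^ 2) = π ^ 4 := by
      rw [show t ^ 4 * (36 * (n : ℝ) ^ 2) = (t ^ 2 * (6 * n)) ^ 2 by ring, ht2]
      ring
    linear_combination 8 * h4
  have hsub := intervalIntegral.integral_comp_mul_left (a := -(π / c)) (b := π / c)
    (fun θ : ℝ ↦ partitionGen (t - θ * Complex.I) * Complex.exp (n * (t - θ * Complex.I))) hc0.ne'
  rw [mul_neg, mul_div_cancel₀ _ hc0.ne', eq_inv_smul_iff₀ hc0.ne'] at hsub
  have hintegrand (u : ℝ) : partitionGen (t - (c * u : ℝ) * Complex.I) *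
      Complex.exp (n * (t - (c * u : ℝ) * Complex.I)) =
      (Real.exp (π * √(2 * n / 3)) * √(t / (2 * π)) : ℝ) * saddleIntegrand t u := by
    have e1 : (t : ℂ) - (c * u : ℝ) * Complex.I = t * saddlePath t u := by
      rw [saddlePath, hc]
      push_cast
      ring
    have e2 : Complex.exp (n * (t * saddlePath t u)) = Real.exp (π * √(2 * n / 3)) *
        Complex.exp ((π ^ 2 / (6 * t) : ℝ) * (saddlePath t u - 2)) := by
      rw [hexp, ← hnt, Complex.ofReal_exp, ← Complex.exp_add]
      congr 1
      push_cast
      ring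
    have hs' : ((√(t / (2 * π)) : ℝ) : ℂ) ≠ 0 := by exact_mod_cast hs.ne'
    rw [e1, e2, saddleIntegrand, Complex.ofReal_mul, mul_div_assoc', eq_div_iff hs']
    ring
  simp_rw [hintegrand] at hsub
  rw [card_partition_eq_integral n ht0, ← hsub, intervalIntegral.integral_const_mul,
    Complex.real_smul, ← mul_assoc, ← mul_assoc]
  congr 1
  have := congrArg (fun x : ℝ ↦ ((Real.exp (π * √(2 * n / 3)) * x : ℝ) : ℂ)) hconst
  rw [show Real.exp (π * √(2 * n / 3)) / (4 * n * √3) / √π =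
    Real.exp (π * √(2 * n / 3)) * (1 / (4 * n * √3) / √π) by ring, ← this]
  push_cast
  ring

theorem hardy_ramanujan_asymptotic_partition_formula :
    Tendsto
      (fun n : ℕ =>
        (Fintype.card (Nat.Partition n) : ℝ) /
          (Real.exp (π * Real.sqrt (2 * n / 3)) / (4 * n * Real.sqrt 3)))
      atTop (nhds 1) := by
  have hpi := Real.pi_pos
  have ht : Tendsto (fun n : ℕ ↦ π / √(6 * n)) atTop (𝓝[>] 0) := by
    refine tendsto_nhdsWithin_iff.mpr ⟨?_, ?_⟩
    · exact (Real.tendsto_sqrt_atTop.comp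
        (tendsto_natCast_atTop_atTop.const_mul_atTop (by norm_num))).const_div_atTop π
    · filter_upwards [eventually_gt_atTop 0] with n hn
      have : (0 : ℝ) < n := by exact_mod_cast hn
      exact Set.mem_Ioi.mpr (by positivity)
  have hlim := (tendsto_integral_saddleIntegrand.comp ht).div_const ((√π : ℝ) : ℂ)
  have hsqrt : ((√π : ℝ) : ℂ) ≠ 0 := by exact_mod_cast (Real.sqrt_pos.mpr hpi).ne'
  rw [div_self hsqrt] at hlim
  have hre := (Complex.continuous_re.tendsto _).comp hlim
  rw [Complex.one_re] at hre
  refine hre.congr' ?_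
  filter_upwards [eventually_gt_atTop 0] with n hn
  have hn' : (0 : ℝ) < n := by exact_mod_cast hn
  have h := card_partition_eq_integral_saddleIntegrand hn rfl
  have hA : 0 < Real.exp (π * √(2 * n / 3)) / (4 * n * √3) := by positivity
  set A := Real.exp (π * √(2 * n / 3)) / (4 * n * √3)
  have hA' : (A : ℂ) ≠ 0 := by exact_mod_cast hA.ne'
  rw [← Complex.ofReal_re ((Fintype.card (Nat.Partition n) : ℝ) / A), Complex.ofReal_div,
    Complex.ofReal_natCast, h, Complex.ofReal_div]
  simp only [Function.comp_apply]
  congr 1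
  field_simp
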